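/- (Case of general position: second frame expansion, relation I₄ = 4·I₆ of (3.10) together with formula (3.6) for I₃) Under the stated assumptions, ∇_X Y = I₃·X + 4·I₆·Y on U, where I₆ = (A_{0.1} − B_{1.0})/(3·F²) − (A·F_{0.1} − B·F_{1.0})/(3·F³) and I₃ = B·(H·G_{1.0} − G·H_{1.0})/(3·F⁹) − A·(H·G_{0.1} − G·H_{0.1})/(3·F⁹) + (H·F_{0.1} + G·F_{1.0})/(3·F⁵) + B·G²·P/(3·F⁹) − (A·G² − 2·H·B·G)·Q/(3·F⁹) + (B·H² − 2·H·A·G)·R/(3·F⁹) − A·H²·S/(3·F⁹). -/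

import Mathlib

noncomputable section

open Real

/-- Partial derivative in the first argument (`f_{1.0}`). -/
def pdx (f : ℝ → ℝ → ℝ) : ℝ → ℝ → ℝ := fun x y => deriv (fun t => f t y) x

/-- Partial derivative in the second argument (`f_{0.1}`). -/
def pdy (f : ℝ → ℝ → ℝ) : ℝ → ℝ → ℝ := fun x y => deriv (fun t => f x t) y

/-- Indexed partial derivative: `0 ↦ ∂/∂x`, `1 ↦ ∂/∂y`. -/
def pd (i : Fin 2) (f : ℝ → ℝ → ℝ) : ℝ → ℝ → ℝ := if i = 0 then pdx f else pdy f

/-- Smoothness of a two-variable real function on a set `U ⊆ ℝ²`. -/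
def Smooth2 (U : Set (ℝ × ℝ)) (f : ℝ → ℝ → ℝ) : Prop :=
  ContDiffOn ℝ (⊤ : ℕ∞) (Function.uncurry f) U

/-- The quantity `A` of formula (1.6). -/
def coefA (P Q R S : ℝ → ℝ → ℝ) : ℝ → ℝ → ℝ := fun x y =>
  pdy (pdy P) x y - 2 * pdx (pdy Q) x y + pdx (pdx R) x y
    + 2 * P x y * pdx S x y + S x y * pdx P x y
    - 3 * P x y * pdy R x y - 3 * R x y * pdy P x y
    - 3 * Q x y * pdx R x y + 6 * Q x y * pdy Q x y

/-- The quantity `B` of formula (1.6). -/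
def coefB (P Q R S : ℝ → ℝ → ℝ) : ℝ → ℝ → ℝ := fun x y =>
  pdx (pdx S) x y - 2 * pdx (pdy R) x y + pdy (pdy Q) x y
    - 2 * S x y * pdy P x y - P x y * pdy S x y
    + 3 * S x y * pdx Q x y + 3 * Q x y * pdx S x y
    + 3 * R x y * pdy Q x y - 6 * R x y * pdx R x y

/-- The quantity `G` of formula (2.4). -/
def coefG (P Q R S : ℝ → ℝ → ℝ) : ℝ → ℝ → ℝ := fun x y =>
  -(coefB P Q R S x y) * pdx (coefB P Q R S) x y
    - 3 * coefA P Q R S x y * pdy (coefB P Q R S) x y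
    + 4 * coefB P Q R S x y * pdy (coefA P Q R S) x y
    + 3 * S x y * (coefA P Q R S x y)^2
    - 6 * R x y * coefA P Q R S x y * coefB P Q R S x y
    + 3 * Q x y * (coefB P Q R S x y)^2

/-- The quantity `H` of formula (2.4). -/
def coefH (P Q R S : ℝ → ℝ → ℝ) : ℝ → ℝ → ℝ := fun x y =>
  -(coefA P Q R S x y) * pdy (coefA P Q R S) x y
    - 3 * coefB P Q R S x y * pdx (coefA P Q R S) x y
    + 4 * coefA P Q R S x y * pdx (coefB P Q R S) x y
    - 3 * P x y * (coefB P Q R S x y)^2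
    + 6 * Q x y * coefA P Q R S x y * coefB P Q R S x y
    - 3 * R x y * (coefA P Q R S x y)^2

/-- The quantity `F⁵` of formula (2.2). -/
def coefF5 (P Q R S : ℝ → ℝ → ℝ) : ℝ → ℝ → ℝ := fun x y =>
  coefA P Q R S x y * coefB P Q R S x y * pdy (coefA P Q R S) x y
    + coefA P Q R S x y * coefB P Q R S x y * pdx (coefB P Q R S) x y
    - (coefA P Q R S x y)^2 * pdy (coefB P Q R S) x y
    - (coefB P Q R S x y)^2 * pdx (coefA P Q R S) x y
    - P x y * (coefB P Q R S x y)^3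
    + 3 * Q x y * coefA P Q R S x y * (coefB P Q R S x y)^2
    - 3 * R x y * (coefA P Q R S x y)^2 * coefB P Q R S x y
    + S x y * (coefA P Q R S x y)^3

/-- The fully covariant symbol `θ_{ijk}` of (2.7) built from the ODE coefficients. -/
def thetaLow (P Q R S : ℝ → ℝ → ℝ) (i j k : Fin 2) : ℝ → ℝ → ℝ :=
  match i.1 + j.1 + k.1 with
  | 0 => P
  | 1 => Q
  | 2 => R
  | _ => S

/-- The symbol `θ^k_{ij}` of (2.8), obtained by raising the first index with `d^{kr}`. -/
def thetaUp (P Q R S : ℝ → ℝ → ℝ) (k i j : Fin 2) : ℝ → ℝ → ℝ :=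
  if k = 0 then thetaLow P Q R S 1 i j
  else fun x y => -(thetaLow P Q R S 0 i j x y)

/-- The affine connection `Γ^k_{ij} = θ^k_{ij} − (φ_i δ^k_j + φ_j δ^k_i)/3` of (3.3)/(4.22). -/
def gamConn (P Q R S phi1 phi2 : ℝ → ℝ → ℝ) (k i j : Fin 2) : ℝ → ℝ → ℝ := fun x y =>
  thetaUp P Q R S k i j x y -
    ((if i = 0 then phi1 x y else phi2 x y) * (if k = j then (1:ℝ) else 0)
      + (if j = 0 then phi1 x y else phi2 x y) * (if k = i then (1:ℝ) else 0)) / 3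

/-- Covariant derivative `(∇_V W)^k = Σ_i V^i (∂W^k/∂x^i + Σ_s Γ^k_{is} W^s)`. -/
def covD (Gam : Fin 2 → Fin 2 → Fin 2 → ℝ → ℝ → ℝ) (V W : Fin 2 → ℝ → ℝ → ℝ)
    (k : Fin 2) : ℝ → ℝ → ℝ := fun x y =>
  ∑ i : Fin 2, V i x y * (pd i (W k) x y + ∑ s : Fin 2, Gam k i s x y * W s x y)

/-- The fifth root `F = (F⁵)^{1/5}` (real power), for the case of general position `F⁵ > 0`. -/
def frF (P Q R S : ℝ → ℝ → ℝ) : ℝ → ℝ → ℝ := fun x y =>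
  (coefF5 P Q R S x y) ^ ((1:ℝ)/5)

/-- `φ₁ = −F_{1.0}/F`. -/
def phiGP1 (P Q R S : ℝ → ℝ → ℝ) : ℝ → ℝ → ℝ := fun x y =>
  -(pdx (frF P Q R S) x y / frF P Q R S x y)

/-- `φ₂ = −F_{0.1}/F`. -/
def phiGP2 (P Q R S : ℝ → ℝ → ℝ) : ℝ → ℝ → ℝ := fun x y =>
  -(pdy (frF P Q R S) x y / frF P Q R S x y)

/-- The vector field `X = F⁻²·(B, −A)` of (3.4). -/
def frameX (P Q R S : ℝ → ℝ → ℝ) (k : Fin 2) : ℝ → ℝ → ℝ := fun x y =>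
  (if k = 0 then coefB P Q R S x y else -(coefA P Q R S x y)) / (frF P Q R S x y)^2

/-- The vector field `Y = F⁻⁴·(G, H)` of (3.4). -/
def frameY (P Q R S : ℝ → ℝ → ℝ) (k : Fin 2) : ℝ → ℝ → ℝ := fun x y =>
  (if k = 0 then coefG P Q R S x y else coefH P Q R S x y) / (frF P Q R S x y)^4

/-- The invariant `I₆` in the simplified form (3.11). -/
def inv6 (P Q R S : ℝ → ℝ → ℝ) : ℝ → ℝ → ℝ := fun x y =>
  (pdy (coefA P Q R S) x y - pdx (coefB P Q R S) x y) / (3 * (frF P Q R S x y)^2)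
    - (coefA P Q R S x y * pdy (frF P Q R S) x y
        - coefB P Q R S x y * pdx (frF P Q R S) x y) / (3 * (frF P Q R S x y)^3)

/-- The invariant `I₃` of formula (3.6). -/
def inv3 (P Q R S : ℝ → ℝ → ℝ) : ℝ → ℝ → ℝ := fun x y =>
  coefB P Q R S x y * (coefH P Q R S x y * pdx (coefG P Q R S) x y
      - coefG P Q R S x y * pdx (coefH P Q R S) x y) / (3 * (frF P Q R S x y)^9)
  - coefA P Q R S x y * (coefH P Q R S x y * pdy (coefG P Q R S) x y
      - coefG P Q R S x y * pdy (coefH P Q R S) x y) / (3 * (frF P Q R S x y)^9)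
  + (coefH P Q R S x y * pdy (frF P Q R S) x y
      + coefG P Q R S x y * pdx (frF P Q R S) x y) / (3 * (frF P Q R S x y)^5)
  + coefB P Q R S x y * (coefG P Q R S x y)^2 * P x y / (3 * (frF P Q R S x y)^9)
  - (coefA P Q R S x y * (coefG P Q R S x y)^2
      - 2 * coefH P Q R S x y * coefB P Q R S x y * coefG P Q R S x y) * Q x y
      / (3 * (frF P Q R S x y)^9)
  + (coefB P Q R S x y * (coefH P Q R S x y)^2
      - 2 * coefH P Q R S x y * coefA P Q R S x y * coefG P Q R S x y) * R x y
      / (3 * (frF P Q R S x y)^9)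
  - coefA P Q R S x y * (coefH P Q R S x y)^2 * S x y / (3 * (frF P Q R S x y)^9)

theorem alg_frame0 (A B Ax Ay Bx By P Q R S F Fx Fy g h Gx Gy Hx Hy : ℝ) (hF : F ≠ 0)
    (hg : g = -B * Bx - 3 * A * By + 4 * B * Ay + 3 * S * A^2 - 6 * R * A * B + 3 * Q * B^2)
    (hh : h = -A * Ay - 3 * B * Ax + 4 * A * Bx - 3 * P * B^2 + 6 * Q * A * B - 3 * R * A^2)
    (h0 : A * g + B * h = 3 * F^5)
    (hx : Ax * g + A * Gx + (Bx * h + B * Hx) = 15 * F^4 * Fx)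
    (hy : Ay * g + A * Gy + (By * h + B * Hy) = 15 * F^4 * Fy) :
    B / F^2 * ((Gx * F^4 - g * (4 * F^3 * Fx)) / (F^4)^2
        + ((Q - (-(Fx / F) + -(Fx / F)) / 3) * (g / F^4)
          + (R - (-(Fy / F)) / 3) * (h / F^4)))
      + -A / F^2 * ((Gy * F^4 - g * (4 * F^3 * Fy)) / (F^4)^2
        + ((R - (-(Fy / F)) / 3) * (g / F^4) + S * (h / F^4)))
    = (B * (h * Gx - g * Hx) / (3 * F^9) - A * (h * Gy - g * Hy) / (3 * F^9)
        + (h * Fy + g * Fx) / (3 * F^5) + B * g^2 * P / (3 * F^9)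
        - (A * g^2 - 2 * h * B * g) * Q / (3 * F^9)
        + (B * h^2 - 2 * h * A * g) * R / (3 * F^9) - A * h^2 * S / (3 * F^9)) * (B / F^2)
      + 4 * ((Ay - Bx) / (3 * F^2) - (A * Fy - B * Fx) / (3 * F^3)) * (g / F^4) := by
  rw [← sub_eq_zero]
  have key : 3 * F^5 * (B * Gx - A * Gy + B * (Q * g + R * h) - A * (R * g + S * h))
      - 15 * F^4 * g * (B * Fx - A * Fy)
      - 4 * F^5 * (Ay - Bx) * g
      - B * (B * (h * Gx - g * Hx) - A * (h * Gy - g * Hy) + B * g^2 * P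
        - (A * g^2 - 2 * h * B * g) * Q + (B * h^2 - 2 * h * A * g) * R - A * h^2 * S) = 0 := by
    linear_combination (-(B * Gx - A * Gy + B * (Q * g + R * h) - A * (R * g + S * h)
      - 4 / 3 * (Ay - Bx) * g)) * h0 + g * (B * hx - A * hy) + (1/3) * g * (h * hg - g * hh)
  rw [← mul_left_inj' (c := 3 * F^11) (by positivity), zero_mul, ← key]
  field_simp
  ring

theorem alg_frame1 (A B Ax Ay Bx By P Q R S F Fx Fy g h Gx Gy Hx Hy : ℝ) (hF : F ≠ 0)
    (hg : g = -B * Bx - 3 * A * By + 4 * B * Ay + 3 * S * A^2 - 6 * R * A * B + 3 * Q * B^2)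
    (hh : h = -A * Ay - 3 * B * Ax + 4 * A * Bx - 3 * P * B^2 + 6 * Q * A * B - 3 * R * A^2)
    (h0 : A * g + B * h = 3 * F^5)
    (hx : Ax * g + A * Gx + (Bx * h + B * Hx) = 15 * F^4 * Fx)
    (hy : Ay * g + A * Gy + (By * h + B * Hy) = 15 * F^4 * Fy) :
    B / F^2 * ((Hx * F^4 - h * (4 * F^3 * Fx)) / (F^4)^2
        + (-P * (g / F^4) + (-Q - (-(Fx / F)) / 3) * (h / F^4)))
      + -A / F^2 * ((Hy * F^4 - h * (4 * F^3 * Fy)) / (F^4)^2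
        + ((-Q - (-(Fx / F)) / 3) * (g / F^4)
          + (-R - (-(Fy / F) + -(Fy / F)) / 3) * (h / F^4)))
    = (B * (h * Gx - g * Hx) / (3 * F^9) - A * (h * Gy - g * Hy) / (3 * F^9)
        + (h * Fy + g * Fx) / (3 * F^5) + B * g^2 * P / (3 * F^9)
        - (A * g^2 - 2 * h * B * g) * Q / (3 * F^9)
        + (B * h^2 - 2 * h * A * g) * R / (3 * F^9) - A * h^2 * S / (3 * F^9)) * (-A / F^2)
      + 4 * ((Ay - Bx) / (3 * F^2) - (A * Fy - B * Fx) / (3 * F^3)) * (h / F^4) := by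
  rw [← sub_eq_zero]
  have key : 3 * F^5 * (B * Hx - A * Hy - B * (P * g + Q * h) + A * (Q * g + R * h))
      - 15 * F^4 * h * (B * Fx - A * Fy)
      - 4 * F^5 * (Ay - Bx) * h
      + A * (B * (h * Gx - g * Hx) - A * (h * Gy - g * Hy) + B * g^2 * P
        - (A * g^2 - 2 * h * B * g) * Q + (B * h^2 - 2 * h * A * g) * R - A * h^2 * S) = 0 := by
    linear_combination (-(B * Hx - A * Hy - B * (P * g + Q * h) + A * (Q * g + R * h)
      - 4 / 3 * (Ay - Bx) * h)) * h0 + h * (B * hx - A * hy) + (1/3) * h * (h * hg - g * hh)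
  rw [← mul_left_inj' (c := 3 * F^11) (by positivity), zero_mul, ← key]
  field_simp
  ring

theorem Smooth2.hasFD {U : Set (ℝ × ℝ)} (hU : IsOpen U) {f : ℝ → ℝ → ℝ} (hf : Smooth2 U f)
    {x y : ℝ} (h : (x, y) ∈ U) :
    HasFDerivAt (Function.uncurry f) (fderiv ℝ (Function.uncurry f) (x, y)) (x, y) :=
  ((hf.contDiffAt (hU.mem_nhds h)).differentiableAt (by simp)).hasFDerivAt

theorem Smooth2.hdx' {U : Set (ℝ × ℝ)} (hU : IsOpen U) {f : ℝ → ℝ → ℝ} (hf : Smooth2 U f)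
    {x y : ℝ} (h : (x, y) ∈ U) :
    HasDerivAt (fun t => f t y) (fderiv ℝ (Function.uncurry f) (x, y) (1, 0)) x := by
  have h1 : HasDerivAt (fun t : ℝ => (t, y)) ((1 : ℝ), (0 : ℝ)) x :=
    (hasDerivAt_id x).prodMk (hasDerivAt_const x y)
  exact HasFDerivAt.comp_hasDerivAt x (f := fun t : ℝ => (t, y)) (hf.hasFD hU h) h1

theorem Smooth2.hdy' {U : Set (ℝ × ℝ)} (hU : IsOpen U) {f : ℝ → ℝ → ℝ} (hf : Smooth2 U f)
    {x y : ℝ} (h : (x, y) ∈ U) :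
    HasDerivAt (fun t => f x t) (fderiv ℝ (Function.uncurry f) (x, y) (0, 1)) y := by
  have h1 : HasDerivAt (fun t : ℝ => (x, t)) ((0 : ℝ), (1 : ℝ)) y :=
    (hasDerivAt_const y x).prodMk (hasDerivAt_id y)
  exact HasFDerivAt.comp_hasDerivAt y (f := fun t : ℝ => (x, t)) (hf.hasFD hU h) h1

theorem Smooth2.hdx {U : Set (ℝ × ℝ)} (hU : IsOpen U) {f : ℝ → ℝ → ℝ} (hf : Smooth2 U f)
    {x y : ℝ} (h : (x, y) ∈ U) : HasDerivAt (fun t => f t y) (pdx f x y) x :=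
  (hf.hdx' hU h).differentiableAt.hasDerivAt

theorem Smooth2.hdy {U : Set (ℝ × ℝ)} (hU : IsOpen U) {f : ℝ → ℝ → ℝ} (hf : Smooth2 U f)
    {x y : ℝ} (h : (x, y) ∈ U) : HasDerivAt (fun t => f x t) (pdy f x y) y :=
  (hf.hdy' hU h).differentiableAt.hasDerivAt

theorem smooth2_pdx {U : Set (ℝ × ℝ)} (hU : IsOpen U) {f : ℝ → ℝ → ℝ} (hf : Smooth2 U f) :
    Smooth2 U (pdx f) := by
  have h1 : ContDiffOn ℝ (⊤ : ℕ∞) (fderiv ℝ (Function.uncurry f)) U :=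
    ContDiffOn.fderiv_of_isOpen hf hU (by simp)
  exact (h1.clm_apply (contDiffOn_const (c := ((1 : ℝ), (0 : ℝ))))).congr
    (fun p hp => (hf.hdx' hU (x := p.1) (y := p.2) hp).deriv)

theorem smooth2_pdy {U : Set (ℝ × ℝ)} (hU : IsOpen U) {f : ℝ → ℝ → ℝ} (hf : Smooth2 U f) :
    Smooth2 U (pdy f) := by
  have h1 : ContDiffOn ℝ (⊤ : ℕ∞) (fderiv ℝ (Function.uncurry f)) U :=
    ContDiffOn.fderiv_of_isOpen hf hU (by simp)
  exact (h1.clm_apply (contDiffOn_const (c := ((0 : ℝ), (1 : ℝ))))).congr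
    (fun p hp => (hf.hdy' hU (x := p.1) (y := p.2) hp).deriv)

theorem Smooth2.add {U : Set (ℝ × ℝ)} {f g : ℝ → ℝ → ℝ} (hf : Smooth2 U f) (hg : Smooth2 U g) :
    Smooth2 U (fun x y => f x y + g x y) := ContDiffOn.add hf hg

theorem Smooth2.sub {U : Set (ℝ × ℝ)} {f g : ℝ → ℝ → ℝ} (hf : Smooth2 U f) (hg : Smooth2 U g) :
    Smooth2 U (fun x y => f x y - g x y) := ContDiffOn.sub hf hg

theorem Smooth2.mul {U : Set (ℝ × ℝ)} {f g : ℝ → ℝ → ℝ} (hf : Smooth2 U f) (hg : Smooth2 U g) :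
    Smooth2 U (fun x y => f x y * g x y) := ContDiffOn.mul hf hg

theorem Smooth2.neg {U : Set (ℝ × ℝ)} {f : ℝ → ℝ → ℝ} (hf : Smooth2 U f) :
    Smooth2 U (fun x y => -f x y) := ContDiffOn.neg hf

theorem Smooth2.pow {U : Set (ℝ × ℝ)} {f : ℝ → ℝ → ℝ} (hf : Smooth2 U f) (n : ℕ) :
    Smooth2 U (fun x y => f x y ^ n) := ContDiffOn.pow hf n

theorem Smooth2.const {U : Set (ℝ × ℝ)} (c : ℝ) :
    Smooth2 U (fun _ _ => c) := contDiffOn_const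

theorem smooth_coefA {U : Set (ℝ × ℝ)} (hU : IsOpen U) {P Q R S : ℝ → ℝ → ℝ}
    (hP : Smooth2 U P) (hQ : Smooth2 U Q) (hR : Smooth2 U R) (hS : Smooth2 U S) :
    Smooth2 U (coefA P Q R S) := by
  unfold coefA
  repeat' first
    | assumption
    | exact Smooth2.const _
    | apply smooth2_pdx hU
    | apply smooth2_pdy hU
    | apply Smooth2.add
    | apply Smooth2.sub
    | apply Smooth2.mul
    | apply Smooth2.neg

theorem smooth_coefB {U : Set (ℝ × ℝ)} (hU : IsOpen U) {P Q R S : ℝ → ℝ → ℝ}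
    (hP : Smooth2 U P) (hQ : Smooth2 U Q) (hR : Smooth2 U R) (hS : Smooth2 U S) :
    Smooth2 U (coefB P Q R S) := by
  unfold coefB
  repeat' first
    | assumption
    | exact Smooth2.const _
    | apply smooth2_pdx hU
    | apply smooth2_pdy hU
    | apply Smooth2.add
    | apply Smooth2.sub
    | apply Smooth2.mul
    | apply Smooth2.neg

theorem smooth_coefG {U : Set (ℝ × ℝ)} (hU : IsOpen U) {P Q R S : ℝ → ℝ → ℝ}
    (hP : Smooth2 U P) (hQ : Smooth2 U Q) (hR : Smooth2 U R) (hS : Smooth2 U S) :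
    Smooth2 U (coefG P Q R S) := by
  have hA := smooth_coefA hU hP hQ hR hS
  have hB := smooth_coefB hU hP hQ hR hS
  unfold coefG
  generalize coefA P Q R S = A at *
  generalize coefB P Q R S = B at *
  repeat' first
    | assumption
    | exact Smooth2.const _
    | apply smooth2_pdx hU
    | apply smooth2_pdy hU
    | apply Smooth2.add
    | apply Smooth2.sub
    | apply Smooth2.mul
    | apply Smooth2.neg
    | apply Smooth2.pow

theorem smooth_coefH {U : Set (ℝ × ℝ)} (hU : IsOpen U) {P Q R S : ℝ → ℝ → ℝ}
    (hP : Smooth2 U P) (hQ : Smooth2 U Q) (hR : Smooth2 U R) (hS : Smooth2 U S) :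
    Smooth2 U (coefH P Q R S) := by
  have hA := smooth_coefA hU hP hQ hR hS
  have hB := smooth_coefB hU hP hQ hR hS
  unfold coefH
  generalize coefA P Q R S = A at *
  generalize coefB P Q R S = B at *
  repeat' first
    | assumption
    | exact Smooth2.const _
    | apply smooth2_pdx hU
    | apply smooth2_pdy hU
    | apply Smooth2.add
    | apply Smooth2.sub
    | apply Smooth2.mul
    | apply Smooth2.neg
    | apply Smooth2.pow

theorem coef_rel (P Q R S : ℝ → ℝ → ℝ) (x y : ℝ) :
    coefA P Q R S x y * coefG P Q R S x y + coefB P Q R S x y * coefH P Q R S x y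
      = 3 * coefF5 P Q R S x y := by
  unfold coefG coefH coefF5
  ring

theorem smooth_frF {U : Set (ℝ × ℝ)} (hU : IsOpen U) {P Q R S : ℝ → ℝ → ℝ}
    (hP : Smooth2 U P) (hQ : Smooth2 U Q) (hR : Smooth2 U R) (hS : Smooth2 U S)
    (hpos : ∀ x y : ℝ, (x, y) ∈ U → 0 < coefF5 P Q R S x y) :
    Smooth2 U (frF P Q R S) := by
  have h5 : Smooth2 U (coefF5 P Q R S) := by
    have h1 := ((Smooth2.const (1/3)).mul
      (((smooth_coefA hU hP hQ hR hS).mul (smooth_coefG hU hP hQ hR hS)).add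
        ((smooth_coefB hU hP hQ hR hS).mul (smooth_coefH hU hP hQ hR hS))))
    refine h1.congr (fun p _ => ?_)
    have := coef_rel P Q R S p.1 p.2
    simp only [Function.uncurry]
    linarith
  exact ContDiffOn.rpow_const_of_ne h5 (fun p hp => (hpos p.1 p.2 hp).ne')

theorem frF_pow {P Q R S : ℝ → ℝ → ℝ} {x y : ℝ} (h : 0 < coefF5 P Q R S x y) :
    frF P Q R S x y ^ 5 = coefF5 P Q R S x y := by
  unfold frF
  rw [← Real.rpow_natCast, ← Real.rpow_mul h.le]
  norm_num

/-- Second frame expansion of (3.5): `∇_X Y = I₃·X + 4·I₆·Y` (formula (3.6) for `I₃`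
and relation `I₄ = 4·I₆` of (3.10)). -/
theorem frame_expansion_XY
    (U : Set (ℝ × ℝ)) (hU : IsOpen U) (hUconn : IsConnected U)
    (P Q R S : ℝ → ℝ → ℝ)
    (hP : Smooth2 U P) (hQ : Smooth2 U Q) (hR : Smooth2 U R) (hS : Smooth2 U S)
    (hpos : ∀ x y : ℝ, (x, y) ∈ U → 0 < coefF5 P Q R S x y) :
    ∀ k : Fin 2, ∀ x y : ℝ, (x, y) ∈ U →
      covD (gamConn P Q R S (phiGP1 P Q R S) (phiGP2 P Q R S))
          (frameX P Q R S) (frameY P Q R S) k x y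
        = inv3 P Q R S x y * frameX P Q R S k x y
          + 4 * inv6 P Q R S x y * frameY P Q R S k x y := by
  intro k x y hxy
  have hA := smooth_coefA hU hP hQ hR hS
  have hB := smooth_coefB hU hP hQ hR hS
  have hG := smooth_coefG hU hP hQ hR hS
  have hH := smooth_coefH hU hP hQ hR hS
  have hFs := smooth_frF hU hP hQ hR hS hpos
  have hF : frF P Q R S x y ≠ 0 := (Real.rpow_pos_of_pos (hpos x y hxy) _).ne'
  have hrel : ∀ x y : ℝ, (x, y) ∈ U →
      coefA P Q R S x y * coefG P Q R S x y + coefB P Q R S x y * coefH P Q R S x y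
        = 3 * frF P Q R S x y ^ 5 := fun x y h => by
    rw [coef_rel, frF_pow (hpos x y h)]
  have h0 := hrel x y hxy
  have hx := (((hA.hdx hU hxy).mul (hG.hdx hU hxy)).add
    ((hB.hdx hU hxy).mul (hH.hdx hU hxy))).unique
    ((((hFs.hdx hU hxy).pow 5).const_mul 3).congr_of_eventuallyEq (by
      have hc : ContinuousAt (fun t : ℝ => (t, y)) x := by fun_prop
      filter_upwards [hc.preimage_mem_nhds (hU.mem_nhds hxy)] with t ht
      exact hrel t y ht))
  have hy := (((hA.hdy hU hxy).mul (hG.hdy hU hxy)).add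
    ((hB.hdy hU hxy).mul (hH.hdy hU hxy))).unique
    ((((hFs.hdy hU hxy).pow 5).const_mul 3).congr_of_eventuallyEq (by
      have hc : ContinuousAt (fun t : ℝ => (x, t)) y := by fun_prop
      filter_upwards [hc.preimage_mem_nhds (hU.mem_nhds hxy)] with t ht
      exact hrel x t ht))
  have hF4 : frF P Q R S x y ^ 4 ≠ 0 := pow_ne_zero 4 hF
  have dGx := ((hG.hdx hU hxy).div ((hFs.hdx hU hxy).pow 4) hF4).deriv
  have dGy := ((hG.hdy hU hxy).div ((hFs.hdy hU hxy).pow 4) hF4).deriv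
  have dHx := ((hH.hdx hU hxy).div ((hFs.hdx hU hxy).pow 4) hF4).deriv
  have dHy := ((hH.hdy hU hxy).div ((hFs.hdy hU hxy).pow 4) hF4).deriv
  have eGx : pdx (frameY P Q R S 0) x y = _ := dGx
  have eGy : pdy (frameY P Q R S 0) x y = _ := dGy
  have eHx : pdx (frameY P Q R S 1) x y = _ := dHx
  have eHy : pdy (frameY P Q R S 1) x y = _ := dHy
  have hg : coefG P Q R S x y = _ := rfl
  have hh : coefH P Q R S x y = _ := rfl
  have hx' := hx.trans (b := _) (c := 15 * frF P Q R S x y ^ 4 * pdx (frF P Q R S) x y)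
    (by push_cast; ring)
  have hy' := hy.trans (b := _) (c := 15 * frF P Q R S x y ^ 4 * pdy (frF P Q R S) x y)
    (by push_cast; ring)
  fin_cases k
  · have key := alg_frame0 _ _ _ _ _ _ (P x y) (Q x y) (R x y) (S x y) _ _ _ _ _ _ _ _ _ hF
      hg hh h0 hx' hy'
    simp [covD, Fin.sum_univ_two, pd, eGx, eGy]
    simp [gamConn, thetaUp, thetaLow, frameX, frameY, phiGP1, phiGP2, inv3, inv6]
    linear_combination key
  · have key := alg_frame1 _ _ _ _ _ _ (P x y) (Q x y) (R x y) (S x y) _ _ _ _ _ _ _ _ _ hF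
      hg hh h0 hx' hy'
    simp [covD, Fin.sum_univ_two, pd, eHx, eHy]
    simp [gamConn, thetaUp, thetaLow, frameX, frameY, phiGP1, phiGP2, inv3, inv6]
    linear_combination key
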